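/- (Proposition 1, part 2: stage-wise policy consistency.) With the stage-wise optimal Q-functions Q*_1, …, Q*_N defined backwards as in Proposition 1 part 1, for every i ∈ {1, …, N} and every s ∈ S_i, an action a₀ maximizes Q*_i(s, ·) over A if and only if it maximizes Q*(s, ·) over A; that is, { a₀ : Q*_i(s, a₀) = ⨆_{a'} Q*_i(s, a') } = { a₀ : Q*(s, a₀) = ⨆_{a'} Q*(s, a') }, so the stage-wise greedy optimal policies agree with the greedy optimal policy of the whole problem on each stage. -/

import Mathlib

/-- The controlled trajectory: `traj f s a 0 = s` and
`traj f s a (t+1) = f (traj f s a t) (a t)`. -/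
def traj {S A : Type*} (f : S → A → S) (s : S) (a : ℕ → A) : ℕ → S
  | 0 => s
  | t + 1 => f (traj f s a t) (a t)

/-- The discounted return `G(s, a) = ∑ₜ γ^t R(s_{t+1}, a_t)`. -/
noncomputable def ret {S A : Type*} (f : S → A → S) (R : S → A → ℝ) (γ : ℝ)
    (s : S) (a : ℕ → A) : ℝ :=
  ∑' t : ℕ, γ ^ t * R (traj f s a (t + 1)) (a t)

/-- The optimal Q-function `Q*(s, a₀) = ⨆ {G(s, a) : a 0 = a₀}`. -/
noncomputable def Qstar {S A : Type*} (f : S → A → S) (R : S → A → ℝ) (γ : ℝ)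
    (s : S) (a₀ : A) : ℝ :=
  ⨆ a : {a : ℕ → A // a 0 = a₀}, ret f R γ s (a : ℕ → A)

open Classical

/-- The stage return `Gᵢ(s,a)` relative to a stage state-set `Sᵢ` and a
next-stage value function `V`: if the stage-transition time
`T = inf {t : s_t ∉ Sᵢ}` is finite,
`Gᵢ(s,a) = ∑_{t<T} γ^t R(s_{t+1}, a_t) + γ^T V(s_T)`; otherwise `Gᵢ(s,a) = G(s,a)`. -/
noncomputable def stageRet {S A : Type*} (f : S → A → S) (R : S → A → ℝ) (γ : ℝ)
    (V : S → ℝ) (Si : Set S) (s : S) (a : ℕ → A) : ℝ :=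
  if ∃ t, traj f s a t ∉ Si then
    (∑ t ∈ Finset.range (sInf {t | traj f s a t ∉ Si}),
        γ ^ t * R (traj f s a (t + 1)) (a t)) +
      γ ^ (sInf {t | traj f s a t ∉ Si}) * V (traj f s a (sInf {t | traj f s a t ∉ Si}))
  else ret f R γ s a

/-- The stage optimal Q-function `Qᵢ*(s, a₀) = ⨆ {Gᵢ(s, a) : a 0 = a₀}`. -/
noncomputable def stageQ {S A : Type*} (f : S → A → S) (R : S → A → ℝ) (γ : ℝ)
    (V : S → ℝ) (Si : Set S) (s : S) (a₀ : A) : ℝ :=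
  ⨆ a : {a : ℕ → A // a 0 = a₀}, stageRet f R γ V Si s (a : ℕ → A)

/-- The stage-wise optimal Q-functions, defined backwards: `Q*_N = Q*`
(and `Q*_i = Q*` for `i ≥ N`), and for `i < N`,
`Q*_i = stageQ` built from the stage set `Sᵢ` and the next-stage optimal value
function `V*_{i+1}(s) = ⨆_{a₀} Q*_{i+1}(s, a₀)`. -/
noncomputable def stageQi {S A : Type*} (f : S → A → S) (R : S → A → ℝ) (γ : ℝ)
    (N : ℕ) (Stage : ℕ → Set S) (i : ℕ) : S → A → ℝ :=
  if h : i < N then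
    stageQ f R γ (fun s => ⨆ a₀ : A, stageQi f R γ N Stage (i + 1) s a₀) (Stage i)
  else Qstar f R γ
termination_by N - i
decreasing_by omega

theorem traj_add {S A : Type*} (f : S → A → S) (s : S) (a : ℕ → A) (m n : ℕ) :
    traj f s a (n + m) = traj f (traj f s a m) (fun t => a (t + m)) n := by
  induction n with
  | zero => simp [traj]
  | succ n ih => rw [Nat.add_right_comm, traj, traj, ih]

theorem traj_congr {S A : Type*} (f : S → A → S) (s : S) {a b : ℕ → A} {n : ℕ}
    (h : ∀ t < n, a t = b t) : traj f s a n = traj f s b n := by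
  induction n with
  | zero => rfl
  | succ n ih =>
    rw [traj, traj, ih fun t ht => h t (ht.trans n.lt_succ_self), h n n.lt_succ_self]

section BoundedReward

variable {S A : Type*} (f : S → A → S) {R : S → A → ℝ} {γ C : ℝ}

theorem norm_discounted_reward_le (hR : ∀ s a, |R s a| ≤ C) (hγ0 : 0 ≤ γ)
    (s : S) (a : ℕ → A) (t : ℕ) :
    ‖γ ^ t * R (traj f s a (t + 1)) (a t)‖ ≤ γ ^ t * C := by
  rw [norm_mul, Real.norm_of_nonneg (pow_nonneg hγ0 t)]
  exact mul_le_mul_of_nonneg_left (hR _ _) (pow_nonneg hγ0 t)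

theorem summable_discounted_reward (hR : ∀ s a, |R s a| ≤ C) (hγ0 : 0 ≤ γ) (hγ1 : γ < 1)
    (s : S) (a : ℕ → A) :
    Summable fun t : ℕ => γ ^ t * R (traj f s a (t + 1)) (a t) :=
  .of_norm_bounded ((summable_geometric_of_lt_one hγ0 hγ1).mul_right C)
    (norm_discounted_reward_le f hR hγ0 s a)

theorem ret_le (hR : ∀ s a, |R s a| ≤ C) (hγ0 : 0 ≤ γ) (hγ1 : γ < 1) (s : S) (a : ℕ → A) :
    ret f R γ s a ≤ ∑' t : ℕ, γ ^ t * C :=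
  (summable_discounted_reward f hR hγ0 hγ1 s a).tsum_le_tsum
    (fun t => (le_abs_self _).trans (norm_discounted_reward_le f hR hγ0 s a t))
    ((summable_geometric_of_lt_one hγ0 hγ1).mul_right C)

/-- The discounted return splits at any time into the reward collected so far and the
discounted return of the remaining trajectory. -/
theorem ret_eq_sum_add (hR : ∀ s a, |R s a| ≤ C) (hγ0 : 0 ≤ γ) (hγ1 : γ < 1)
    (s : S) (a : ℕ → A) (n : ℕ) :
    ret f R γ s a = (∑ t ∈ Finset.range n, γ ^ t * R (traj f s a (t + 1)) (a t)) +
      γ ^ n * ret f R γ (traj f s a n) (fun t => a (t + n)) := by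
  rw [ret, ← (summable_discounted_reward f hR hγ0 hγ1 s a).sum_add_tsum_nat_add n, ret,
    ← tsum_mul_left]
  congr 2
  ext t
  rw [Nat.add_right_comm t n 1, traj_add, pow_add]
  ring

theorem ret_le_Qstar (hR : ∀ s a, |R s a| ≤ C) (hγ0 : 0 ≤ γ) (hγ1 : γ < 1)
    (s : S) (a : ℕ → A) : ret f R γ s a ≤ Qstar f R γ s (a 0) :=
  le_ciSup (f := fun b : {b : ℕ → A // b 0 = a 0} => ret f R γ s (b : ℕ → A))
    ⟨∑' t : ℕ, γ ^ t * C, by rintro _ ⟨b, rfl⟩; exact ret_le f hR hγ0 hγ1 s b⟩ ⟨a, rfl⟩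

theorem Qstar_le (hR : ∀ s a, |R s a| ≤ C) (hγ0 : 0 ≤ γ) (hγ1 : γ < 1) (s : S) (a₀ : A) :
    Qstar f R γ s a₀ ≤ ∑' t : ℕ, γ ^ t * C :=
  have : Nonempty {a : ℕ → A // a 0 = a₀} := ⟨⟨fun _ => a₀, rfl⟩⟩
  ciSup_le fun a => ret_le f hR hγ0 hγ1 s a

theorem ret_le_iSup_Qstar (hR : ∀ s a, |R s a| ≤ C) (hγ0 : 0 ≤ γ) (hγ1 : γ < 1)
    (s : S) (a : ℕ → A) : ret f R γ s a ≤ ⨆ a₀, Qstar f R γ s a₀ :=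
  (ret_le_Qstar f hR hγ0 hγ1 s a).trans
    (le_ciSup (f := Qstar f R γ s)
      ⟨∑' t : ℕ, γ ^ t * C, by rintro _ ⟨b, rfl⟩; exact Qstar_le f hR hγ0 hγ1 s b⟩ (a 0))

/-- Following `a` up to a positive time `n` and then collecting the optimal value does not beat
the optimal Q-function at the first action of `a`. -/
theorem sum_add_iSup_Qstar_le [Nonempty A] (hR : ∀ s a, |R s a| ≤ C) (hγ0 : 0 ≤ γ) (hγ1 : γ < 1)
    (s : S) (a : ℕ → A) {n : ℕ} (hn : 0 < n) :
    (∑ t ∈ Finset.range n, γ ^ t * R (traj f s a (t + 1)) (a t)) +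
      γ ^ n * (⨆ a₀, Qstar f R γ (traj f s a n) a₀) ≤ Qstar f R γ s (a 0) := by
  rw [← le_sub_iff_add_le', Real.mul_iSup_of_nonneg (pow_nonneg hγ0 n)]
  refine ciSup_le fun a₀ => ?_
  have : Nonempty {a : ℕ → A // a 0 = a₀} := ⟨⟨fun _ => a₀, rfl⟩⟩
  rw [Qstar, Real.mul_iSup_of_nonneg (pow_nonneg hγ0 n)]
  refine ciSup_le fun b => ?_
  rw [le_sub_iff_add_le']
  let c : ℕ → A := fun t => if t < n then a t else b.1 (t - n)
  have hc : ∀ t < n, c t = a t := fun t ht => if_pos ht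
  have hshift : (fun t => c (t + n)) = b.1 := by
    ext t
    simp [c]
  have h := ret_le_Qstar f hR hγ0 hγ1 s c
  rw [ret_eq_sum_add f hR hγ0 hγ1 s c n, hshift, traj_congr f s hc, hc 0 hn] at h
  refine le_of_eq_of_le ?_ h
  congr 1
  refine Finset.sum_congr rfl fun t ht => ?_
  have ht := Finset.mem_range.1 ht
  rw [hc t ht, traj_congr f s fun u hu => hc u (by omega)]

/-- If the continuation value agrees with the optimal value at every state reachable in one step
from the stage, then the stage Q-function agrees with the optimal Q-function on the stage. -/
theorem stageQ_eq_Qstar [Nonempty A] (hR : ∀ s a, |R s a| ≤ C) (hγ0 : 0 ≤ γ) (hγ1 : γ < 1)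
    {V : S → ℝ} {Si : Set S}
    (hV : ∀ s ∈ Si, ∀ a, V (f s a) = ⨆ a₀, Qstar f R γ (f s a) a₀)
    {s : S} (hs : s ∈ Si) (a₀ : A) :
    stageQ f R γ V Si s a₀ = Qstar f R γ s a₀ := by
  have : Nonempty {a : ℕ → A // a 0 = a₀} := ⟨⟨fun _ => a₀, rfl⟩⟩
  have hexit : ∀ a : ℕ → A, (∃ t, traj f s a t ∉ Si) →
      0 < sInf {t | traj f s a t ∉ Si} ∧
        V (traj f s a (sInf {t | traj f s a t ∉ Si})) =
          ⨆ a₀, Qstar f R γ (traj f s a (sInf {t | traj f s a t ∉ Si})) a₀ := by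
    intro a ha
    have hmem : traj f s a (sInf {t | traj f s a t ∉ Si}) ∉ Si := Nat.sInf_mem ha
    have hlt : ∀ t < sInf {t | traj f s a t ∉ Si}, traj f s a t ∈ Si := fun t ht =>
      not_not.1 (Nat.notMem_of_lt_sInf ht)
    generalize sInf {t | traj f s a t ∉ Si} = T at hmem hlt
    cases T with
    | zero => exact absurd hs hmem
    | succ T => exact ⟨T.succ_pos, hV _ (hlt T T.lt_succ_self) _⟩
  have hle : ∀ a : {a : ℕ → A // a 0 = a₀},
      stageRet f R γ V Si s (a : ℕ → A) ≤ Qstar f R γ s a₀ := by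
    rintro ⟨a, rfl⟩
    rw [stageRet]
    split_ifs with ha
    · obtain ⟨hpos, hval⟩ := hexit a ha
      rw [hval]
      exact sum_add_iSup_Qstar_le f hR hγ0 hγ1 s a hpos
    · exact ret_le_Qstar f hR hγ0 hγ1 s a
  refine le_antisymm (ciSup_le hle) (ciSup_mono ⟨_, Set.forall_mem_range.2 hle⟩ ?_)
  rintro ⟨a, -⟩
  rw [stageRet]
  split_ifs with ha
  · rw [(hexit a ha).2, ret_eq_sum_add f hR hγ0 hγ1 s a (sInf {t | traj f s a t ∉ Si})]
    gcongr
    exact ret_le_iSup_Qstar f hR hγ0 hγ1 _ _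
  · exact le_rfl

theorem stageQi_eq_Qstar [Nonempty A] (hR : ∀ s a, |R s a| ≤ C) (hγ0 : 0 ≤ γ) (hγ1 : γ < 1)
    {N : ℕ} {Stage : ℕ → Set S}
    (htrans : ∀ i, 1 ≤ i → i < N → ∀ s ∈ Stage i, ∀ a : A, f s a ∈ Stage (i + 1))
    {i : ℕ} (hi : 1 ≤ i) (hiN : i ≤ N) :
    ∀ s ∈ Stage i, stageQi f R γ N Stage i s = Qstar f R γ s := by
  induction hiN using Nat.decreasingInduction with
  | self =>
    intro s _
    rw [stageQi, dif_neg (lt_irrefl N)]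
  | of_succ k hk ih =>
    intro s hs
    ext a₀
    rw [stageQi, dif_pos hk]
    refine stageQ_eq_Qstar f hR hγ0 hγ1 (fun s hs a => ?_) hs a₀
    simp only [ih (by omega) _ (htrans k hi hk s hs a)]

end BoundedReward

/-- (Proposition 1, part 2: stage-wise policy consistency.)
For an `N`-stage structure, at every stage `i ∈ {1, …, N}` and every `s ∈ Sᵢ`,
an action maximizes the stage-wise optimal Q-function `Q*ᵢ(s, ·)` iff it
maximizes the optimal Q-function `Q*(s, ·)` of the whole problem; that is, the
stage-wise greedy optimal policies agree with the greedy optimal policy of the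
whole problem on each stage. -/
theorem stagewise_policy_consistency {S A : Type*} [Nonempty A]
    (f : S → A → S) (R : S → A → ℝ) (γ C : ℝ)
    (hC : 0 ≤ C) (hR : ∀ s a, |R s a| ≤ C)
    (hγ0 : 0 ≤ γ) (hγ1 : γ < 1)
    (N : ℕ) (Stage : ℕ → Set S)
    (hchain : ∀ i, 1 ≤ i → i < N → Stage i ⊆ Stage (i + 1))
    (htop : Stage N = Set.univ)
    (htrans : ∀ i, 1 ≤ i → i < N → ∀ s ∈ Stage i, ∀ a : A, f s a ∈ Stage (i + 1)) :
    ∀ i, 1 ≤ i → i ≤ N → ∀ s ∈ Stage i,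
      {a₀ : A | stageQi f R γ N Stage i s a₀ = ⨆ a' : A, stageQi f R γ N Stage i s a'} =
        {a₀ : A | Qstar f R γ s a₀ = ⨆ a' : A, Qstar f R γ s a'} := by
  intro i hi hiN s hs
  rw [stageQi_eq_Qstar f hR hγ0 hγ1 htrans hi hiN s hs]
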